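/- arXiv:1011.5491 — 2 statements merged into one kernel-verified Lean document; each statement's English description precedes it below -/
import Mathlib

section
/- Let w be a word over the positive integers and let σ be a separable permutation. If w contains σ as a pattern, then the partition shape(σ) is contained in the partition shape(w), i.e., for every i the i-th part of shape(σ) is at most the i-th part of shape(w). -/
/-- A weakly increasing subsequence of the word `w`, given as a set of positions. -/
def WkInc (w : List ℕ) (S : Finset (Fin w.length)) : Prop :=
  ∀ p ∈ S, ∀ q ∈ S, p < q → w.get p ≤ w.get q

/-- The maximum total number of elements in a union of `d` pairwise disjoint weakly
increasing subsequences of `w`; by Greene's theorem this equals `μ₁ + ⋯ + μ_d` where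
`μ = shape(w)` is the RSK shape of `w`. -/
noncomputable def greene (w : List ℕ) (d : ℕ) : ℕ :=
  sSup {N | ∃ S : Fin d → Finset (Fin w.length),
    (∀ i, WkInc w (S i)) ∧ (∀ i j, i ≠ j → Disjoint (S i) (S j)) ∧
    N = ∑ i, (S i).card}

/-- The `(k+1)`-st part (0-indexed `k`-th part) of the RSK shape of `w`. -/
noncomputable def shapePart (w : List ℕ) (k : ℕ) : ℕ := greene w (k + 1) - greene w k

/-- The word `w` contains the permutation `π` as a pattern. -/
def ContainsPattern {m : ℕ} (π : Equiv.Perm (Fin m)) (w : List ℕ) : Prop :=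
  ∃ f : Fin m → Fin w.length, StrictMono f ∧
    ∀ j k : Fin m,
      (w.get (f j) < w.get (f k) ↔ π j < π k) ∧
      (w.get (f k) < w.get (f j) ↔ π k < π j)

/-- The pattern 3142 (one-line notation), 0-indexed. -/
def p3142 : Equiv.Perm (Fin 4) := ⟨![2,0,3,1], ![1,3,0,2], by decide, by decide⟩

/-- The pattern 2413 (one-line notation), 0-indexed. -/
def p2413 : Equiv.Perm (Fin 4) := ⟨![1,3,0,2], ![2,0,3,1], by decide, by decide⟩

/-- The one-line word of a permutation of `[n] = {1,…,n}`. -/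
def permWord {n : ℕ} (σ : Equiv.Perm (Fin n)) : List ℕ :=
  List.ofFn fun i => (σ i : ℕ) + 1

/-- A permutation is separable iff it avoids both 3142 and 2413. -/
def Separable {n : ℕ} (σ : Equiv.Perm (Fin n)) : Prop :=
  ¬ ContainsPattern p3142 (permWord σ) ∧ ¬ ContainsPattern p2413 (permWord σ)

/-- A (strictly) increasing subsequence of the permutation `σ`, as a set of positions. -/
def IncSubseq {n : ℕ} (σ : Equiv.Perm (Fin n)) (S : Finset (Fin n)) : Prop :=
  ∀ p ∈ S, ∀ q ∈ S, p < q → σ p < σ q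

section SeparablePatterns

open Finset

variable {α β : Type*} [LinearOrder α] [LinearOrder β]

/-- The set `X` of positions breaks into a nonempty initial part and a nonempty final part,
with the values of `v` on one part all smaller than those on the other. -/
def Splits (v : α → β) (X : Finset α) : Prop :=
  ∃ L R : Finset α, L.Nonempty ∧ R.Nonempty ∧ L ∪ R = X ∧ (∀ l ∈ L, ∀ r ∈ R, l < r) ∧
    ((∀ l ∈ L, ∀ r ∈ R, v l < v r) ∨ (∀ l ∈ L, ∀ r ∈ R, v r < v l))

theorem splits_toDual {v : α → β} {X : Finset α} :
    Splits (OrderDual.toDual ∘ v) X ↔ Splits v X := by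
  constructor <;> rintro ⟨L, R, hL, hR, h, hlt, hv⟩ <;> exact ⟨L, R, hL, hR, h, hlt, hv.symm⟩

/-- Values of `v` at four increasing positions never form the pattern 3142. -/
def Avoids3142 (v : α → β) : Prop :=
  ∀ a b c d, a < b → b < c → c < d → v b < v d → v d < v a → ¬ v a < v c

theorem Splits.insert_of_lt {v : α → β} (hv : Function.Injective v) (havoid : Avoids3142 v)
    {L R : Finset α} {z : α} (hL : L.Nonempty) (hR : R.Nonempty)
    (hpos : ∀ l ∈ L, ∀ r ∈ R, l < r) (hval : ∀ l ∈ L, ∀ r ∈ R, v l < v r)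
    (hz : ∀ x ∈ L ∪ R, x < z) (h : Splits v (insert z L)) : Splits v (insert z (L ∪ R)) := by
  obtain ⟨A, B, hA, hB, hAB, hABpos, hABval⟩ := h
  have hmem : ∀ x, x ∈ A ∨ x ∈ B ↔ x = z ∨ x ∈ L := fun x => by
    rw [← mem_union, hAB, mem_insert]
  have hzA : z ∉ A := by
    intro hzA
    obtain ⟨b, hb⟩ := hB
    have := hABpos z hzA b hb
    rcases (hmem b).1 (Or.inr hb) with rfl | hbL
    · exact lt_irrefl _ this
    · exact lt_asymm this (hz b (mem_union_left _ hbL))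
  have hAL : ∀ x ∈ A, x ∈ L := fun x hx =>
    ((hmem x).1 (Or.inl hx)).resolve_left fun h => hzA (h ▸ hx)
  have hzB : z ∈ B := ((hmem z).2 (Or.inl rfl)).resolve_left hzA
  rcases hABval with hval' | hval'
  · refine ⟨A, B ∪ R, hA, hB.mono subset_union_left, ?_, ?_, Or.inl ?_⟩
    · rw [← union_assoc, hAB, insert_union]
    · intro l hl r hr
      rcases mem_union.1 hr with hr | hr
      exacts [hABpos l hl r hr, hpos l (hAL l hl) r hr]
    · intro l hl r hr
      rcases mem_union.1 hr with hr | hr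
      exacts [hval' l hl r hr, hval l (hAL l hl) r hr]
  · have hzL : ∀ x ∈ L, v z < v x := by
      intro x hx
      rcases (hmem x).2 (Or.inr hx) with hxA | hxB
      · exact hval' x hxA z hzB
      · by_contra hlt
        have hxz := hz x (mem_union_left _ hx)
        obtain ⟨a, ha⟩ := hA
        obtain ⟨r, hr⟩ := hR
        exact havoid a x r z (hABpos a ha x hxB) (hpos x hx r hr) (hz r (mem_union_right _ hr))
          (lt_of_le_of_ne (not_lt.1 hlt) (hv.ne hxz.ne)) (hval' a ha z hzB)
          (hval a (hAL a ha) r hr)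
    refine ⟨L ∪ R, {z}, hL.mono subset_union_left, singleton_nonempty z, ?_, ?_, Or.inr ?_⟩
    · rw [union_comm, ← insert_eq]
    · simpa using hz
    · intro l hl r hr
      rw [mem_singleton.1 hr]
      rcases mem_union.1 hl with hl | hl
      · exact hzL l hl
      · obtain ⟨x, hx⟩ := hL
        exact (hzL x hx).trans (hval x hx l hl)

/-- Any set of at least two positions splits when the patterns 3142 and 2413 are avoided. -/
theorem splits_of_avoids {v : α → β} (hv : Function.Injective v) (h₁ : Avoids3142 v)
    (h₂ : Avoids3142 (OrderDual.toDual ∘ v)) (X : Finset α) (hX : 2 ≤ #X) : Splits v X := by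
  induction hn : #X using Nat.strong_induction_on generalizing X with
  | _ n ih =>
    have hne : X.Nonempty := card_pos.1 (by omega)
    have hzX := X.max'_mem hne
    set z := X.max' hne with hzdef
    have hlast : ∀ x ∈ X.erase z, x < z := fun x hx =>
      lt_of_le_of_ne (X.le_max' x (mem_of_mem_erase hx)) (ne_of_mem_erase hx)
    have hcard := card_erase_of_mem hzX
    rw [← insert_erase hzX]
    by_cases h2 : #X = 2
    · obtain ⟨y, hy⟩ := card_eq_one.1 (show #(X.erase z) = 1 by omega)
      have hyz : y < z := hlast y (by simp [hy])
      rw [hy]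
      refine ⟨{y}, {z}, singleton_nonempty y, singleton_nonempty z, ?_, ?_, ?_⟩
      · rw [union_comm, ← insert_eq]
      · simpa using hyz
      · simpa using lt_or_gt_of_ne (hv.ne hyz.ne)
    · obtain ⟨L, R, hL, hR, hLR, hpos, hval⟩ := ih #(X.erase z) (by omega) _ (by omega) rfl
      rw [← hLR] at hlast ⊢
      have hzL : z ∉ L := fun h => lt_irrefl _ (hlast z (mem_union_left _ h))
      have hdisj : Disjoint L R := disjoint_left.2 fun x hl hr => lt_irrefl _ (hpos x hl x hr)
      have hsum := card_union_of_disjoint hdisj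
      rw [hLR] at hsum
      have hLpos := hL.card_pos
      have hRpos := hR.card_pos
      have hins := card_insert_of_notMem hzL
      have hs := ih #(insert z L) (by omega) _ (by omega) rfl
      rcases hval with hval | hval
      · exact hs.insert_of_lt hv h₁ hL hR hpos hval hlast
      · exact splits_toDual.1 ((splits_toDual.2 hs).insert_of_lt
          (OrderDual.toDual.injective.comp hv) h₂ hL hR hpos hval hlast)

/-- `U` is a union of `k` pairwise disjoint weakly increasing subsequences of `v`. -/
def IncCover (v : α → β) (k : ℕ) (U : Finset α) : Prop :=
  ∃ c : α → ℕ, (∀ x ∈ U, c x < k) ∧ ∀ x ∈ U, ∀ y ∈ U, c x = c y → x < y → v x ≤ v y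

theorem incCover_of_card_image_le {v : α → β} {U : Finset α} (c : α → ℕ)
    (hc : ∀ x ∈ U, ∀ y ∈ U, c x = c y → x < y → v x ≤ v y) {k : ℕ} (hk : #(U.image c) ≤ k) :
    IncCover v k U := by
  classical
  let e := (U.image c).equivFin
  let g : ℕ → ℕ := fun i => if h : i ∈ U.image c then e ⟨i, h⟩ else 0
  refine ⟨g ∘ c, fun x hx => ?_, fun x hx y hy hxy => hc x hx y hy ?_⟩
  · have h := mem_image_of_mem c hx
    simp only [g, Function.comp, dif_pos h]
    exact (e _).isLt.trans_le hk
  · simp only [g, Function.comp, dif_pos (mem_image_of_mem c hx),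
      dif_pos (mem_image_of_mem c hy)] at hxy
    exact congrArg Subtype.val (e.injective (Fin.ext hxy))

theorem IncCover.mono {v : α → β} {k l : ℕ} {U : Finset α} (h : IncCover v k U) (hkl : k ≤ l) :
    IncCover v l U := by
  obtain ⟨c, hc, h⟩ := h
  exact ⟨c, fun x hx => (hc x hx).trans_le hkl, h⟩

theorem IncCover.subset {v : α → β} {k : ℕ} {U V : Finset α} (h : IncCover v k U) (hV : V ⊆ U) :
    IncCover v k V := by
  obtain ⟨c, hc, h⟩ := h
  exact ⟨c, fun x hx => hc x (hV hx), fun x hx y hy => h x (hV hx) y (hV hy)⟩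

theorem incCover_empty (v : α → β) (k : ℕ) : IncCover v k ∅ := ⟨fun _ => 0, by simp, by simp⟩

theorem IncCover.eq_empty {v : α → β} {U : Finset α} (h : IncCover v 0 U) : U = ∅ := by
  obtain ⟨c, hc, -⟩ := h
  exact eq_empty_of_forall_notMem fun x hx => absurd (hc x hx) (Nat.not_lt_zero _)

theorem IncCover.union {v : α → β} {k l : ℕ} {U V : Finset α} (hU : IncCover v k U)
    (hV : IncCover v l V) : IncCover v (k + l) (U ∪ V) := by
  classical
  obtain ⟨c, hc, hc'⟩ := hU
  obtain ⟨d, hd, hd'⟩ := hV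
  refine ⟨fun x => if x ∈ U then c x else k + d x, ?_, ?_⟩
  · intro x hx
    dsimp only
    split_ifs with h
    · have := hc x h; omega
    · have := hd x ((mem_union.1 hx).resolve_left h); omega
  · intro x hx y hy hxy
    dsimp only at hxy
    split_ifs at hxy with h h' h'
    · exact hc' x h y h' hxy
    · have := hc x h; omega
    · have := hc y h'; omega
    · exact hd' x ((mem_union.1 hx).resolve_left h) y ((mem_union.1 hy).resolve_left h') (by omega)

theorem IncCover.union_of_lt {v : α → β} {k : ℕ} {U V : Finset α} (hU : IncCover v k U)
    (hV : IncCover v k V) (hpos : ∀ x ∈ U, ∀ y ∈ V, x < y) (hval : ∀ x ∈ U, ∀ y ∈ V, v x < v y) :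
    IncCover v k (U ∪ V) := by
  classical
  obtain ⟨c, hc, hc'⟩ := hU
  obtain ⟨d, hd, hd'⟩ := hV
  have hUV : ∀ x ∈ V, x ∉ U := fun x hx hx' => lt_irrefl _ (hpos x hx' x hx)
  refine ⟨fun x => if x ∈ U then c x else d x, ?_, ?_⟩
  · intro x hx
    dsimp only
    split_ifs with h
    · exact hc x h
    · exact hd x ((mem_union.1 hx).resolve_left h)
  · intro x hx y hy hxy hlt
    rcases mem_union.1 hx with hx | hx <;> rcases mem_union.1 hy with hy | hy
    · exact hc' x hx y hy (by simpa [hx, hy] using hxy) hlt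
    · exact (hval x hx y hy).le
    · exact absurd hlt (hpos y hy x hx).asymm
    · exact hd' x hx y hy (by simpa [hUV x hx, hUV y hy] using hxy) hlt

/-- A union of `k` increasing subsequences distributes them over two parts between which
nothing increases. -/
theorem IncCover.exists_add_le {v : α → β} {k : ℕ} {U P Q : Finset α} (hU : IncCover v k U)
    (hpos : ∀ x ∈ P, ∀ y ∈ Q, x < y) (hval : ∀ x ∈ P, ∀ y ∈ Q, v y < v x) :
    ∃ a b, a + b ≤ k ∧ IncCover v a (U ∩ P) ∧ IncCover v b (U ∩ Q) := by
  classical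
  obtain ⟨c, hc, h⟩ := hU
  refine ⟨#((U ∩ P).image c), #((U ∩ Q).image c), ?_,
    incCover_of_card_image_le c (fun x hx y hy => h x (mem_inter.1 hx).1 y (mem_inter.1 hy).1) le_rfl,
    incCover_of_card_image_le c (fun x hx y hy => h x (mem_inter.1 hx).1 y (mem_inter.1 hy).1) le_rfl⟩
  have hdisj : Disjoint ((U ∩ P).image c) ((U ∩ Q).image c) := by
    rw [disjoint_left]
    simp only [mem_image, mem_inter]
    rintro _ ⟨x, ⟨hxU, hxP⟩, rfl⟩ ⟨y, ⟨hyU, hyQ⟩, hxy⟩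
    exact (h x hxU y hyU hxy.symm (hpos x hxP y hyQ)).not_gt (hval x hxP y hyQ)
  rw [← card_union_of_disjoint hdisj, ← card_range k]
  refine card_le_card fun i hi => ?_
  simp only [mem_union, mem_image, mem_inter] at hi
  rcases hi with ⟨x, hx, rfl⟩ | ⟨x, hx, rfl⟩ <;> exact mem_range.2 (hc x hx.1)

/-- If at most `k` increasing subsequences are removed from `X`, there remains an increasing
subsequence at least as long as the gain in passing from `k` to `k + 1` subsequences of `X`. -/
def HasLongRemainder (v : α → β) (X : Finset α) : Prop :=
  ∀ k : ℕ, ∀ U ⊆ X, ∀ V ⊆ X, IncCover v (k + 1) U → IncCover v k V →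
    ∃ U' ⊆ X, ∃ D ⊆ X, IncCover v k U' ∧ IncCover v 1 D ∧ Disjoint D V ∧ #U ≤ #U' + #D

theorem hasLongRemainder_of_card_le_one (v : α → β) {X : Finset α} (hX : #X ≤ 1) :
    HasLongRemainder v X := by
  intro k U hU V hV hcU hcV
  rcases k with _ | k
  · rw [hcV.eq_empty]
    exact ⟨∅, empty_subset _, U, hU, incCover_empty v 0, hcU, disjoint_empty_right _, by simp⟩
  · refine ⟨U, hU, ∅, empty_subset _, ?_, incCover_empty v 1, disjoint_empty_left _, by simp⟩
    refine ⟨fun _ => 0, by simp, fun x hx y hy _ hlt => ?_⟩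
    rw [card_le_one.1 hX x (hU hx) y (hU hy)]

theorem HasLongRemainder.union_of_lt {v : α → β} {P Q : Finset α} (hP : HasLongRemainder v P)
    (hQ : HasLongRemainder v Q) (hpos : ∀ x ∈ P, ∀ y ∈ Q, x < y)
    (hval : ∀ x ∈ P, ∀ y ∈ Q, v x < v y) : HasLongRemainder v (P ∪ Q) := by
  intro k U hU V hV hcU hcV
  obtain ⟨U₁, hU₁, D₁, hD₁, hcU₁, hcD₁, hd₁, hle₁⟩ := hP k (U ∩ P) inter_subset_right (V ∩ P)
    inter_subset_right (hcU.subset inter_subset_left) (hcV.subset inter_subset_left)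
  obtain ⟨U₂, hU₂, D₂, hD₂, hcU₂, hcD₂, hd₂, hle₂⟩ := hQ k (U ∩ Q) inter_subset_right (V ∩ Q)
    inter_subset_right (hcU.subset inter_subset_left) (hcV.subset inter_subset_left)
  have hPQ : Disjoint P Q := disjoint_left.2 fun x hx hx' => lt_irrefl _ (hpos x hx x hx')
  refine ⟨U₁ ∪ U₂, union_subset_union hU₁ hU₂, D₁ ∪ D₂, union_subset_union hD₁ hD₂,
    hcU₁.union_of_lt hcU₂ (fun x hx y hy => hpos x (hU₁ hx) y (hU₂ hy))
      (fun x hx y hy => hval x (hU₁ hx) y (hU₂ hy)),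
    hcD₁.union_of_lt hcD₂ (fun x hx y hy => hpos x (hD₁ hx) y (hD₂ hy))
      (fun x hx y hy => hval x (hD₁ hx) y (hD₂ hy)), ?_, ?_⟩
  · rw [disjoint_left] at hd₁ hd₂ ⊢
    intro x hx hxV
    rcases mem_union.1 hx with hx | hx
    exacts [hd₁ hx (mem_inter.2 ⟨hxV, hD₁ hx⟩), hd₂ hx (mem_inter.2 ⟨hxV, hD₂ hx⟩)]
  · rw [card_union_of_disjoint (hPQ.mono hU₁ hU₂), card_union_of_disjoint (hPQ.mono hD₁ hD₂)]
    have : #U ≤ #(U ∩ P) + #(U ∩ Q) := by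
      have h := card_union_le (U ∩ P) (U ∩ Q)
      rwa [← inter_union_distrib_left, inter_eq_left.2 hU] at h
    omega

/-- If `P` still has more subsequences in `U` than in `V`, one of them can be released. -/
theorem HasLongRemainder.exists_release {v : α → β} {P Q U V : Finset α}
    (hP : HasLongRemainder v P) (hPQ : Disjoint P Q) (hU : U ⊆ P ∪ Q) {k a b i : ℕ}
    (ha : IncCover v a (U ∩ P)) (hb : IncCover v b (U ∩ Q)) (hi : IncCover v i (V ∩ P))
    (hia : i < a) (hab : a + b = k + 1) :
    ∃ U' ⊆ P ∪ Q, ∃ D ⊆ P ∪ Q, IncCover v k U' ∧ IncCover v 1 D ∧ Disjoint D V ∧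
      #U ≤ #U' + #D := by
  obtain ⟨a, rfl⟩ : ∃ a', a = a' + 1 := ⟨a - 1, by omega⟩
  obtain ⟨U₁, hU₁, D, hD, hcU₁, hcD, hd, hle⟩ := hP a (U ∩ P) inter_subset_right (V ∩ P)
    inter_subset_right ha (hi.mono (by omega))
  refine ⟨U₁ ∪ (U ∩ Q), union_subset_union hU₁ inter_subset_right, D,
    hD.trans subset_union_left, (hcU₁.union hb).mono (by omega), hcD, ?_, ?_⟩
  · rw [disjoint_left] at hd ⊢
    exact fun x hx hxV => hd hx (mem_inter.2 ⟨hxV, hD hx⟩)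
  · rw [card_union_of_disjoint (hPQ.mono hU₁ inter_subset_right)]
    have : #U ≤ #(U ∩ P) + #(U ∩ Q) := by
      have h := card_union_le (U ∩ P) (U ∩ Q)
      rwa [← inter_union_distrib_left, inter_eq_left.2 hU] at h
    omega

theorem HasLongRemainder.union_of_gt {v : α → β} {P Q : Finset α} (hP : HasLongRemainder v P)
    (hQ : HasLongRemainder v Q) (hpos : ∀ x ∈ P, ∀ y ∈ Q, x < y)
    (hval : ∀ x ∈ P, ∀ y ∈ Q, v y < v x) : HasLongRemainder v (P ∪ Q) := by
  intro k U hU V hV hcU hcV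
  have hPQ : Disjoint P Q := disjoint_left.2 fun x hx hx' => lt_irrefl _ (hpos x hx x hx')
  obtain ⟨a, b, hab, ha, hb⟩ := hcU.exists_add_le hpos hval
  obtain ⟨i, j, hij, hi, hj⟩ := hcV.exists_add_le hpos hval
  rcases hab.lt_or_eq with hlt | heq
  · have h := ha.union hb
    rw [← inter_union_distrib_left, inter_eq_left.2 hU] at h
    exact ⟨U, hU, ∅, empty_subset _, h.mono (by omega), incCover_empty v 1,
      disjoint_empty_left _, by simp⟩
  · rcases (by omega : i < a ∨ j < b) with h | h
    · exact hP.exists_release hPQ hU ha hb hi h heq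
    · rw [union_comm] at hU ⊢
      exact hQ.exists_release hPQ.symm hU hb ha hj h (by omega)

theorem hasLongRemainder_of_avoids {v : α → β} (hv : Function.Injective v) (h₁ : Avoids3142 v)
    (h₂ : Avoids3142 (OrderDual.toDual ∘ v)) (X : Finset α) : HasLongRemainder v X := by
  induction hn : #X using Nat.strong_induction_on generalizing X with
  | _ n ih =>
    by_cases hX : #X ≤ 1
    · exact hasLongRemainder_of_card_le_one v hX
    · obtain ⟨L, R, hL, hR, rfl, hpos, hval⟩ := splits_of_avoids hv h₁ h₂ X (by omega)
      have hdisj : Disjoint L R := disjoint_left.2 fun x hl hr => lt_irrefl _ (hpos x hl x hr)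
      have hsum := card_union_of_disjoint hdisj
      have hLpos := hL.card_pos
      have hRpos := hR.card_pos
      have hl := ih #L (by omega) L rfl
      have hr := ih #R (by omega) R rfl
      rcases hval with hval | hval
      · exact hl.union_of_lt hr hpos hval
      · exact hl.union_of_gt hr hpos hval

theorem greene_set_bddAbove (w : List ℕ) (d : ℕ) :
    BddAbove {N | ∃ S : Fin d → Finset (Fin w.length),
      (∀ i, WkInc w (S i)) ∧ (∀ i j, i ≠ j → Disjoint (S i) (S j)) ∧ N = ∑ i, #(S i)} := by
  refine ⟨w.length, ?_⟩
  rintro _ ⟨S, -, hdisj, rfl⟩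
  rw [← card_biUnion fun i _ j _ hij => hdisj i j hij]
  exact (card_le_univ _).trans_eq (Fintype.card_fin _)

theorem IncCover.card_le_greene {w : List ℕ} {k : ℕ} {U : Finset (Fin w.length)}
    (h : IncCover w.get k U) : #U ≤ greene w k := by
  obtain ⟨c, hc, h⟩ := h
  refine le_csSup (greene_set_bddAbove w k)
    ⟨fun i => U.filter fun x => c x = i, fun i p hp q hq hpq => ?_, fun i j hij => ?_, ?_⟩
  · simp only [mem_filter] at hp hq
    exact h p hp.1 q hq.1 (hp.2.trans hq.2.symm) hpq
  · rw [disjoint_left]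
    intro x hx hx'
    simp only [mem_filter] at hx hx'
    exact hij (Fin.ext (hx.2.symm.trans hx'.2))
  · rw [← card_biUnion]
    · congr 1
      ext x
      simp only [mem_biUnion, mem_univ, true_and, mem_filter]
      exact ⟨fun hx => ⟨⟨c x, hc x hx⟩, hx, rfl⟩, fun ⟨_, hx, _⟩ => hx⟩
    · intro i _ j _ hij
      simp only [disjoint_left, mem_filter]
      exact fun x hx hx' => hij (Fin.ext (hx.2.symm.trans hx'.2))

theorem exists_incCover_card_eq_greene (w : List ℕ) (k : ℕ) :
    ∃ U : Finset (Fin w.length), IncCover w.get k U ∧ #U = greene w k := by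
  classical
  have hne : {N | ∃ S : Fin k → Finset (Fin w.length),
      (∀ i, WkInc w (S i)) ∧ (∀ i j, i ≠ j → Disjoint (S i) (S j)) ∧
      N = ∑ i, #(S i)}.Nonempty :=
    ⟨0, fun _ => ∅, by simp [WkInc], by simp, by simp⟩
  obtain ⟨S, hS, hdisj, hN⟩ := Nat.sSup_mem hne (greene_set_bddAbove w k)
  refine ⟨univ.biUnion S, ?_, ?_⟩
  · have hex : ∀ x, ∃ n : ℕ, x ∈ univ.biUnion S → ∃ i : Fin k, (i : ℕ) = n ∧ x ∈ S i := by
      intro x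
      by_cases hx : x ∈ univ.biUnion S
      · obtain ⟨i, -, hi⟩ := mem_biUnion.1 hx
        exact ⟨i, fun _ => ⟨i, rfl, hi⟩⟩
      · exact ⟨0, fun h => absurd h hx⟩
    choose c hc using hex
    refine ⟨c, fun x hx => ?_, fun x hx y hy hxy hlt => ?_⟩
    · obtain ⟨i, hi, -⟩ := hc x hx
      exact hi ▸ i.isLt
    · obtain ⟨i, hi, hxi⟩ := hc x hx
      obtain ⟨j, hj, hyj⟩ := hc y hy
      obtain rfl : i = j := Fin.ext (by omega)
      exact hS i x hxi y hyj hlt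
  · rw [card_biUnion fun i _ j _ hij => hdisj i j hij]
    exact hN.symm

theorem containsPattern_of_strictMono {m : ℕ} {π : Equiv.Perm (Fin m)} {w : List ℕ}
    (f : Fin m → Fin w.length) (hf : StrictMono f)
    (h : ∀ j k, π j < π k → w.get (f j) < w.get (f k)) : ContainsPattern π w := by
  have hiff : ∀ j k, w.get (f j) < w.get (f k) ↔ π j < π k := by
    refine fun j k => ⟨fun hlt => ?_, h j k⟩
    rcases lt_trichotomy (π j) (π k) with h' | h' | h'
    · exact h'
    · rw [π.injective h'] at hlt
      exact absurd hlt (lt_irrefl _)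
    · exact absurd hlt (h k j h').asymm
  exact ⟨f, hf, fun j k => ⟨hiff j k, hiff k j⟩⟩

theorem Separable.avoids3142 {n : ℕ} {σ : Equiv.Perm (Fin n)} (h : Separable σ) :
    Avoids3142 (permWord σ).get := by
  intro a b c d hab hbc hcd h₁ h₂ h₃
  refine h.1 (containsPattern_of_strictMono ![a, b, c, d] ?_ ?_)
  · rw [Fin.strictMono_iff_lt_succ]
    intro i
    fin_cases i <;> assumption
  · have h₄ := h₁.trans h₂
    have h₅ := h₂.trans h₃
    have h₆ := h₄.trans h₃
    intro j k hjk
    fin_cases j <;> fin_cases k <;> first | assumption | exact absurd hjk (by decide)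

theorem Separable.avoids3142_toDual {n : ℕ} {σ : Equiv.Perm (Fin n)} (h : Separable σ) :
    Avoids3142 (OrderDual.toDual ∘ (permWord σ).get) := by
  intro a b c d hab hbc hcd h₁ h₂ h₃
  replace h₁ : (permWord σ).get d < (permWord σ).get b := h₁
  replace h₂ : (permWord σ).get a < (permWord σ).get d := h₂
  replace h₃ : (permWord σ).get c < (permWord σ).get a := h₃
  refine h.2 (containsPattern_of_strictMono ![a, b, c, d] ?_ ?_)
  · rw [Fin.strictMono_iff_lt_succ]
    intro i
    fin_cases i <;> assumption
  · have h₄ := h₂.trans h₁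
    have h₅ := h₃.trans h₂
    have h₆ := h₃.trans h₄
    intro j k hjk
    fin_cases j <;> fin_cases k <;> first | assumption | exact absurd hjk (by decide)

theorem permWord_length {n : ℕ} (σ : Equiv.Perm (Fin n)) : (permWord σ).length = n :=
  List.length_ofFn

theorem permWord_get {n : ℕ} (σ : Equiv.Perm (Fin n)) (i : Fin (permWord σ).length) :
    (permWord σ).get i = (σ (i.cast (permWord_length σ)) : ℕ) + 1 :=
  List.get_ofFn _ i

theorem permWord_get_injective {n : ℕ} (σ : Equiv.Perm (Fin n)) :
    Function.Injective (permWord σ).get := by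
  intro i j hij
  rw [permWord_get, permWord_get] at hij
  exact Fin.cast_injective _ (σ.injective (Fin.ext (by omega)))

theorem ContainsPattern.exists_orderEmbedding {n : ℕ} {σ : Equiv.Perm (Fin n)} {w : List ℕ}
    (h : ContainsPattern σ w) : ∃ f : Fin (permWord σ).length ↪o Fin w.length,
      ∀ i j, w.get (f i) ≤ w.get (f j) ↔ (permWord σ).get i ≤ (permWord σ).get j := by
  obtain ⟨f, hf, h⟩ := h
  refine ⟨OrderEmbedding.ofStrictMono (fun i => f (i.cast (permWord_length σ)))
    fun i j hij => hf hij, fun i j => ?_⟩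
  rw [← not_lt, ← not_lt, not_iff_not, permWord_get, permWord_get, add_lt_add_iff_right,
    ← Fin.lt_def]
  exact (h _ _).1

end SeparablePatterns

/-- If a word `w` (over the positive integers) contains a separable permutation `σ`
as a pattern, then `shape(σ) ⊆ shape(w)`, i.e. every part of `shape(σ)` is at most
the corresponding part of `shape(w)`. -/
theorem shape_containment_of_separable_pattern {n : ℕ} (σ : Equiv.Perm (Fin n))
    (hsep : Separable σ) (w : List ℕ) (hw : ∀ x ∈ w, 0 < x)
    (hpat : ContainsPattern σ w) :
    ∀ k : ℕ, shapePart (permWord σ) k ≤ shapePart w k := by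
  classical
  intro k
  obtain ⟨f, hf⟩ := hpat.exists_orderEmbedding
  obtain ⟨A, hA, hAcard⟩ := exists_incCover_card_eq_greene w k
  obtain ⟨U, hU, hUcard⟩ := exists_incCover_card_eq_greene (permWord σ) (k + 1)
  have hV : IncCover (permWord σ).get k (Finset.univ.filter fun i => f i ∈ A) := by
    obtain ⟨c, hc, h⟩ := hA
    refine ⟨c ∘ f, fun x hx => hc _ (Finset.mem_filter.1 hx).2, fun x hx y hy hxy hlt => ?_⟩
    exact (hf x y).1 (h _ (Finset.mem_filter.1 hx).2 _ (Finset.mem_filter.1 hy).2 hxy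
      (f.strictMono hlt))
  obtain ⟨U', -, D, -, hU', ⟨c, hc, hD⟩, hdisj, hle⟩ :=
    hasLongRemainder_of_avoids (permWord_get_injective σ) hsep.avoids3142
      hsep.avoids3142_toDual Finset.univ k U (Finset.subset_univ _) _ (Finset.subset_univ _) hU hV
  have hfD : IncCover w.get 1 (D.map f.toEmbedding) := by
    refine ⟨fun _ => 0, fun _ _ => Nat.one_pos, fun x hx y hy _ hlt => ?_⟩
    obtain ⟨i, hi, rfl⟩ := Finset.mem_map.1 hx
    obtain ⟨j, hj, rfl⟩ := Finset.mem_map.1 hy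
    have hi0 := hc i hi
    have hj0 := hc j hj
    exact (hf i j).2 (hD i hi j hj (by omega) (f.lt_iff_lt.1 hlt))
  have hAD : Disjoint A (D.map f.toEmbedding) := by
    rw [Finset.disjoint_right]
    intro x hx hxA
    obtain ⟨i, hi, rfl⟩ := Finset.mem_map.1 hx
    exact Finset.disjoint_left.1 hdisj hi (Finset.mem_filter.2 ⟨Finset.mem_univ _, hxA⟩)
  have hw' := (hA.union hfD).card_le_greene
  rw [Finset.card_union_of_disjoint hAD, Finset.card_map] at hw'
  have hσ' := hU'.card_le_greene
  unfold shapePart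
  omega
end

section
/- Let σ be a separable permutation. If u, w, w′ are increasing subsequences of σ with w and w′ disjoint and u ⊆ w ∪ w′, then there exists an increasing subsequence β of σ with u ⊆ β ⊆ w ∪ w′ such that (w ∪ w′) ∖ β is also an increasing subsequence of σ. -/
/-- The positions `p` and `q` form an inversion of `σ`. -/
def Inverted {n : ℕ} (σ : Equiv.Perm (Fin n)) (p q : Fin n) : Prop :=
  (p < q ∧ σ q < σ p) ∨ (q < p ∧ σ p < σ q)

theorem Inverted.symm {n : ℕ} {σ : Equiv.Perm (Fin n)} {p q : Fin n}
    (h : Inverted σ p q) : Inverted σ q p :=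
  Or.symm h

theorem IncSubseq.not_inverted {n : ℕ} {σ : Equiv.Perm (Fin n)} {S : Finset (Fin n)}
    (hS : IncSubseq σ S) {p q : Fin n} (hp : p ∈ S) (hq : q ∈ S) : ¬ Inverted σ p q := by
  rintro (⟨h₁, h₂⟩ | ⟨h₁, h₂⟩)
  · exact lt_asymm h₂ (hS p hp q hq h₁)
  · exact lt_asymm h₂ (hS q hq p hp h₁)

theorem incSubseq_of_not_inverted {n : ℕ} {σ : Equiv.Perm (Fin n)} {S : Finset (Fin n)}
    (hS : ∀ p ∈ S, ∀ q ∈ S, ¬ Inverted σ p q) : IncSubseq σ S := by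
  intro p hp q hq hpq
  by_contra h
  exact hS p hp q hq
    (.inl ⟨hpq, lt_of_le_of_ne (not_lt.mp h) fun e => hpq.ne' (σ.injective e)⟩)

theorem containsPattern_permWord {n m : ℕ} {σ : Equiv.Perm (Fin n)} {π : Equiv.Perm (Fin m)}
    (f : Fin m → Fin n) (hf : StrictMono f) (h : ∀ j k, σ (f j) < σ (f k) ↔ π j < π k) :
    ContainsPattern π (permWord σ) := by
  have hlen : n = (permWord σ).length := by simp [permWord]
  refine ⟨fun i => Fin.cast hlen (f i), fun i j hij => hf hij, fun j k => ?_⟩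
  rw [← h j k, ← h k j]
  simp only [permWord, List.get_ofFn, add_lt_add_iff_right, Fin.val_fin_lt]
  exact ⟨Iff.rfl, Iff.rfl⟩

theorem Separable.not_2413 {n : ℕ} {σ : Equiv.Perm (Fin n)} (hsep : Separable σ)
    {a b c d : Fin n} (hab : a < b) (hbc : b < c) (hcd : c < d) (hca : σ c < σ a)
    (had : σ a < σ d) (hdb : σ d < σ b) : False := by
  refine hsep.2 (containsPattern_permWord ![a, b, c, d] ?_ ?_)
  · rw [Fin.strictMono_iff_lt_succ]
    intro i
    fin_cases i <;> assumption
  · intro j k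
    fin_cases j <;> fin_cases k <;> simp [p2413] <;> order

theorem Separable.not_3142 {n : ℕ} {σ : Equiv.Perm (Fin n)} (hsep : Separable σ)
    {a b c d : Fin n} (hab : a < b) (hbc : b < c) (hcd : c < d) (hbd : σ b < σ d)
    (hda : σ d < σ a) (hac : σ a < σ c) : False := by
  refine hsep.1 (containsPattern_permWord ![a, b, c, d] ?_ ?_)
  · rw [Fin.strictMono_iff_lt_succ]
    intro i
    fin_cases i <;> assumption
  · intro j k
    fin_cases j <;> fin_cases k <;> simp [p3142] <;> order

/-- The inversion graph of a separable permutation has no induced path on four vertices. -/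
theorem Separable.inverted_of_path {n : ℕ} {σ : Equiv.Perm (Fin n)} (hsep : Separable σ)
    {a b c d : Fin n} (hab : Inverted σ a b) (hbc : Inverted σ b c) (hcd : Inverted σ c d)
    (hac : ¬ Inverted σ a c) (hbd : ¬ Inverted σ b d) : Inverted σ a d := by
  by_contra had
  have hne : ∀ {p q : Fin n}, p ≠ q → (σ p : ℕ) ≠ σ q := fun h e =>
    h (σ.injective (Fin.ext e))
  have nac : a ≠ c := by rintro rfl; exact had hcd
  have nbd : b ≠ d := by rintro rfl; exact had hab
  have nad : a ≠ d := by rintro rfl; exact hac hcd.symm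
  have vac := hne nac
  have vbd := hne nbd
  have vad := hne nad
  have h₁ := @Separable.not_2413 n σ hsep a c b d
  have h₂ := @Separable.not_2413 n σ hsep d b c a
  have h₃ := @Separable.not_3142 n σ hsep b a d c
  have h₄ := @Separable.not_3142 n σ hsep c d a b
  simp only [Inverted, Fin.lt_def, ne_eq, Fin.ext_iff] at *
  grind

/-- If `u`, `w`, `w'` are increasing subsequences of a separable permutation `σ` with
`w` and `w'` disjoint and `u ⊆ w ∪ w'`, then there is an increasing subsequence `β`
with `u ⊆ β ⊆ w ∪ w'` whose complement `(w ∪ w') \ β` is again increasing. -/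
theorem exists_increasing_through_u {n : ℕ} (σ : Equiv.Perm (Fin n))
    (hsep : Separable σ) (u w w' : Finset (Fin n))
    (hu : IncSubseq σ u) (hw : IncSubseq σ w) (hw' : IncSubseq σ w')
    (hdisj : Disjoint w w') (husub : u ⊆ w ∪ w') :
    ∃ β : Finset (Fin n), IncSubseq σ β ∧ u ⊆ β ∧ β ⊆ w ∪ w' ∧
      IncSubseq σ ((w ∪ w') \ β) := by
  classical
  have mem : ∀ {x}, x ∈ u → x ∈ w ∨ x ∈ w' := fun hx => Finset.mem_union.mp (husub hx)
  have cross : ∀ {x y}, x ∈ w → (y ∈ w ∨ y ∈ w') → Inverted σ x y → y ∈ w' := fun hx hy h =>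
    hy.resolve_left fun hy => hw.not_inverted hx hy h
  have cross' : ∀ {x y}, x ∈ w' → (y ∈ w ∨ y ∈ w') → Inverted σ x y → y ∈ w := fun hx hy h =>
    hy.resolve_right fun hy => hw'.not_inverted hx hy h
  -- Each component of the inversion graph on `w ∪ w'` is complete bipartite; `β` takes the
  -- side meeting `u` in every component that meets `u`, and the side in `w` elsewhere.
  let β := (w ∪ w').filter fun x => (∀ z ∈ u, ¬ Inverted σ x z) ∧
    (x ∈ w ∨ x ∈ u ∨ ∃ y ∈ w ∪ w', ∃ z ∈ u, Inverted σ x y ∧ Inverted σ y z)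
  refine ⟨β, ?_, ?_, Finset.filter_subset _ _, ?_⟩
  · have key : ∀ x ∈ β, ∀ y ∈ β, x ∈ w → ¬ Inverted σ x y := by
      intro x hx y hy hxw hxy
      simp only [β, Finset.mem_filter, Finset.mem_union] at hx hy
      have hyw' := cross hxw hy.1 hxy
      rcases hy.2.2 with hyw | hyu | ⟨s, hs, z, hz, hys, hsz⟩
      · exact Finset.disjoint_left.mp hdisj hyw hyw'
      · exact hx.2.1 y hyu hxy
      · have hsw := cross' hyw' hs hys
        have hzw' := cross hsw (mem hz) hsz
        exact hx.2.1 z hz (hsep.inverted_of_path hxy hys hsz (hw.not_inverted hxw hsw)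
          (hw'.not_inverted hyw' hzw'))
    refine incSubseq_of_not_inverted fun x hx y hy hxy => ?_
    rcases Finset.mem_union.mp (Finset.mem_filter.mp hx).1 with hxw | hxw'
    · exact key x hx y hy hxw hxy
    · exact key y hy x hx
        (cross' hxw' (Finset.mem_union.mp (Finset.mem_filter.mp hy).1) hxy) hxy.symm
  · intro x hx
    exact Finset.mem_filter.mpr
      ⟨husub hx, fun z hz => hu.not_inverted hx hz, .inr (.inl hx)⟩
  · have key : ∀ x ∈ (w ∪ w') \ β, ∀ y ∈ (w ∪ w') \ β, x ∈ w → ¬ Inverted σ x y := by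
      intro x hx y hy hxw hxy
      rw [Finset.mem_sdiff] at hx hy
      have hyw' := cross hxw (Finset.mem_union.mp hy.1) hxy
      obtain ⟨z, hz, hxz⟩ : ∃ z ∈ u, Inverted σ x z := by
        by_contra! h
        exact hx.2 (Finset.mem_filter.mpr ⟨hx.1, h, .inl hxw⟩)
      obtain ⟨t, ht, hyt⟩ : ∃ t ∈ u, Inverted σ y t := by
        by_contra! h
        exact hy.2 (Finset.mem_filter.mpr
          ⟨hy.1, h, .inr (.inr ⟨x, hx.1, z, hz, hxy.symm, hxz⟩)⟩)
      exact hu.not_inverted ht hz (hsep.inverted_of_path hyt.symm hxy.symm hxz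
        (hw.not_inverted (cross' hyw' (mem ht) hyt) hxw)
        (hw'.not_inverted hyw' (cross hxw (mem hz) hxz)))
    refine incSubseq_of_not_inverted fun x hx y hy hxy => ?_
    rcases Finset.mem_union.mp (Finset.mem_sdiff.mp hx).1 with hxw | hxw'
    · exact key x hx y hy hxw hxy
    · exact key y hy x hx
        (cross' hxw' (Finset.mem_union.mp (Finset.mem_sdiff.mp hy).1) hxy) hxy.symm
end
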